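/- For any r-form Φ and any (r+1)-form Ω (r = 0 or 1) on ℤ², (d^cΦ, Ω)_V = −(1/2) tr⟨∂V, Φ∪∗Ω⟩ + (Φ, δ^cΩ)_V. -/

import Mathlib

open Matrix BigOperators

noncomputable section

/-- 2×2 complex matrices. -/
abbrev Mat : Type := Matrix (Fin 2) (Fin 2) ℂ

/-- A discrete 0-form on ℤ². -/
abbrev ZForm0 : Type := ℤ → ℤ → Mat
/-- A discrete 1-form on ℤ². -/
abbrev ZForm1 : Type := ZForm0 × ZForm0
/-- A discrete 2-form on ℤ². -/
abbrev ZForm2 : Type := ℤ → ℤ → Mat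

/-- Coboundary on 0-forms. -/
def d0 (Φ : ZForm0) : ZForm1 :=
  (fun k s => Φ (k + 1) s - Φ k s, fun k s => Φ k (s + 1) - Φ k s)

/-- Coboundary on 1-forms. -/
def d1 (Ω : ZForm1) : ZForm2 :=
  fun k s => Ω.2 (k + 1) s - Ω.2 k s - Ω.1 k (s + 1) + Ω.1 k s

/-- Cup product of a 0-form and a 1-form. -/
def cup01 (Φ : ZForm0) (Θ : ZForm1) : ZForm1 :=
  (fun k s => Φ k s * Θ.1 k s, fun k s => Φ k s * Θ.2 k s)

/-- Cup product of a 1-form and a 0-form. -/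
def cup10 (Θ : ZForm1) (Φ : ZForm0) : ZForm1 :=
  (fun k s => Θ.1 k s * Φ (k + 1) s, fun k s => Θ.2 k s * Φ k (s + 1))

/-- Star operator on 1-forms. -/
def star1 (Ω : ZForm1) : ZForm1 :=
  (fun k s => -Ω.2 k (s - 1), fun k s => Ω.1 (k - 1) s)

/-- Star operator on 2-forms. -/
def star2 (Ψ : ZForm2) : ZForm0 := fun k s => Ψ (k - 1) (s - 1)

/-- Codifferential on 1-forms. -/
def delta1 (Ω : ZForm1) : ZForm0 :=
  fun k s => Ω.1 (k - 1) s - Ω.1 k s + Ω.2 k (s - 1) - Ω.2 k s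

/-- Codifferential on 2-forms. -/
def delta2 (Ψ : ZForm2) : ZForm1 :=
  (fun k s => Ψ k s - Ψ k (s - 1), fun k s => -(Ψ k s - Ψ (k - 1) s))

/-- Inner product of 0-forms over the rectangle `V = {1,…,N}×{1,…,M}`. -/
def inner0V (N M : ℕ) (Φ Ω : ZForm0) : ℂ :=
  -(1 / 2) * ∑ k ∈ Finset.Icc (1 : ℤ) (N : ℤ), ∑ s ∈ Finset.Icc (1 : ℤ) (M : ℤ),
    Matrix.trace (Φ k s * Ω k s)

/-- Inner product of 1-forms over the rectangle `V`. -/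
def inner1V (N M : ℕ) (Φ Ω : ZForm1) : ℂ :=
  -(1 / 2) * ∑ k ∈ Finset.Icc (1 : ℤ) (N : ℤ), ∑ s ∈ Finset.Icc (1 : ℤ) (M : ℤ),
    Matrix.trace (Φ.1 k s * Ω.1 k s + Φ.2 k s * Ω.2 k s)

/-- Inner product of 2-forms over the rectangle `V`. -/
def inner2V (N M : ℕ) (Φ Ω : ZForm2) : ℂ :=
  -(1 / 2) * ∑ k ∈ Finset.Icc (1 : ℤ) (N : ℤ), ∑ s ∈ Finset.Icc (1 : ℤ) (M : ℤ),
    Matrix.trace (Φ k s * Ω k s)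

/-- Boundary pairing `⟨∂V, Θ⟩` of a 1-form `Θ`. -/
def pairBoundary (N M : ℕ) (Θ : ZForm1) : Mat :=
  (∑ k ∈ Finset.Icc (1 : ℤ) (N : ℤ), Θ.1 k 1)
    + (∑ s ∈ Finset.Icc (1 : ℤ) (M : ℤ), Θ.2 ((N : ℤ) + 1) s)
    - (∑ k ∈ Finset.Icc (1 : ℤ) (N : ℤ), Θ.1 k ((M : ℤ) + 1))
    - (∑ s ∈ Finset.Icc (1 : ℤ) (M : ℤ), Θ.2 1 s)

theorem sum_Icc_one_int_telescope {A : Type*} [AddCommGroup A] (f : ℤ → A) (n : ℕ) :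
    ∑ k ∈ Finset.Icc (1 : ℤ) (n : ℤ), (f (k + 1) - f k) = f ((n : ℤ) + 1) - f 1 := by
  induction n with
  | zero => simp
  | succ n ih =>
    have h : Finset.Icc (1 : ℤ) ((n + 1 : ℕ) : ℤ)
        = insert ((n : ℤ) + 1) (Finset.Icc (1 : ℤ) (n : ℤ)) := by
      ext x
      simp only [Finset.mem_Icc, Finset.mem_insert]
      omega
    rw [h, Finset.sum_insert (by simp), ih]
    push_cast
    abel

/-- Discrete Stokes formula on the rectangle `V`. -/
theorem pairBoundary_eq_sum_d1 (N M : ℕ) (Θ : ZForm1) :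
    pairBoundary N M Θ
      = ∑ k ∈ Finset.Icc (1 : ℤ) (N : ℤ), ∑ s ∈ Finset.Icc (1 : ℤ) (M : ℤ), d1 Θ k s := by
  have h : ∀ k s, d1 Θ k s
      = (Θ.2 (k + 1) s - Θ.2 k s) - (Θ.1 k (s + 1) - Θ.1 k s) := by
    intro k s
    simp only [d1]
    abel
  simp only [h, Finset.sum_sub_distrib (f := fun s => Θ.2 (_ + 1) s - Θ.2 _ s)]
  rw [Finset.sum_sub_distrib, Finset.sum_comm]
  simp only [fun s => sum_Icc_one_int_telescope (fun k => Θ.2 k s) N,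
    fun k => sum_Icc_one_int_telescope (fun s => Θ.1 k s) M]
  simp only [pairBoundary, Finset.sum_sub_distrib]
  abel

theorem trace_pairBoundary (N M : ℕ) (Θ : ZForm1) :
    Matrix.trace (pairBoundary N M Θ)
      = ∑ k ∈ Finset.Icc (1 : ℤ) (N : ℤ), ∑ s ∈ Finset.Icc (1 : ℤ) (M : ℤ),
        Matrix.trace (d1 Θ k s) := by
  simp only [pairBoundary_eq_sum_d1, Matrix.trace_sum]

/-- Leibniz rule for a 0-form and the star of a 1-form. -/
theorem d1_cup01_star1_add (Φ : ZForm0) (Ω : ZForm1) (k s : ℤ) :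
    d1 (cup01 Φ (star1 Ω)) k s + Φ k s * delta1 Ω k s
      = (d0 Φ).1 k s * Ω.1 k s + (d0 Φ).2 k s * Ω.2 k s := by
  simp only [d1, d0, cup01, star1, delta1, add_sub_cancel_right]
  noncomm_ring

/-- Leibniz rule for a 1-form and the star of a 2-form. -/
theorem d1_cup10_star2_add (Φ : ZForm1) (Ω : ZForm2) (k s : ℤ) :
    d1 (cup10 Φ (star2 Ω)) k s
        + (Φ.1 k s * (delta2 Ω).1 k s + Φ.2 k s * (delta2 Ω).2 k s)
      = d1 Φ k s * Ω k s := by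
  simp only [d1, cup10, star2, delta2, add_sub_cancel_right]
  noncomm_ring

/-- for an `r`-form `Φ` and an `(r+1)`-form `Ω` (`r = 0, 1`) on ℤ²,
`(d^cΦ, Ω)_V = −(1/2) tr⟨∂V, Φ∪∗Ω⟩ + (Φ, δ^cΩ)_V`. -/
theorem discrete_green_formula (N M : ℕ) (hN : 0 < N) (hM : 0 < M) :
    (∀ (Φ : ZForm0) (Ω : ZForm1),
      inner1V N M (d0 Φ) Ω
        = -(1 / 2) * Matrix.trace (pairBoundary N M (cup01 Φ (star1 Ω)))
          + inner0V N M Φ (delta1 Ω)) ∧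
    (∀ (Φ : ZForm1) (Ω : ZForm2),
      inner2V N M (d1 Φ) Ω
        = -(1 / 2) * Matrix.trace (pairBoundary N M (cup10 Φ (star2 Ω)))
          + inner1V N M Φ (delta2 Ω)) := by
  refine ⟨fun Φ Ω => ?_, fun Φ Ω => ?_⟩
  · simp only [inner1V, inner0V, trace_pairBoundary, ← mul_add, ← Finset.sum_add_distrib,
      ← Matrix.trace_add, d1_cup01_star1_add]
  · simp only [inner2V, inner1V, trace_pairBoundary, ← mul_add, ← Finset.sum_add_distrib,
      ← Matrix.trace_add (R := ℂ), d1_cup10_star2_add]
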